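/- arXiv:2007.00395 — 2 statements merged into one kernel-verified Lean document; each statement's English description precedes it below -/
import Mathlib

section
/- For all sufficiently large m there exists a bipartite graph H with parts A and B of size 7m each, which is 256-regular, together with distinguished subsets A' ⊆ A and B' ⊆ B of size 2m each, such that for every X ⊆ A' and Y ⊆ B' with |X| = |Y| ≤ m, the graph H − (X ∪ Y) has a perfect matching. -/
open Finset in
theorem card_perm_image_eq {α : Type*} [Fintype α] [DecidableEq α] (S S' : Finset α)
    (h : #S' = #S) :
    #{σ : Equiv.Perm α | S.image σ = S'} = #{σ : Equiv.Perm α | S.image σ = S} := by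
  obtain ⟨τ, hτ⟩ : ∃ τ : Equiv.Perm α, S.image τ = S' := by
    let e : {x // x ∈ S} ≃ {x // x ∈ S'} := Finset.equivOfCardEq h.symm
    refine ⟨e.extendSubtype, ?_⟩
    refine Finset.eq_of_subset_of_card_le ?_ ?_
    · intro y hy
      obtain ⟨x, hx, rfl⟩ := Finset.mem_image.1 hy
      exact e.extendSubtype_mem x hx
    · rw [Finset.card_image_of_injective _ (Equiv.injective _), h]
  refine Finset.card_equiv (Equiv.mulLeft τ⁻¹) fun σ => ?_
  simp only [mem_filter, mem_univ, true_and, Equiv.coe_mulLeft, Equiv.Perm.coe_mul]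
  rw [← Finset.image_image, ← hτ]
  constructor
  · intro h
    rw [h, Finset.image_image, ← Equiv.Perm.coe_mul]
    simp
  · intro h
    have := congrArg (Finset.image τ) h
    rwa [Finset.image_image, ← Equiv.Perm.coe_mul, mul_inv_cancel, Equiv.Perm.coe_one,
      Finset.image_id] at this

theorem choose_mul_pow_le {t n : ℕ} (h : t ≤ n) (s : ℕ) :
    t.choose s * n ^ s ≤ t ^ s * n.choose s := by
  have key : t.descFactorial s * n ^ s ≤ t ^ s * n.descFactorial s := by
    induction s with
    | zero => simp
    | succ s ih =>
      have h1 : (t - s) * n ≤ t * (n - s) := by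
        rw [Nat.sub_mul, Nat.mul_sub, mul_comm t s]
        exact Nat.sub_le_sub_left (Nat.mul_le_mul_left s h) _
      rw [Nat.descFactorial_succ, Nat.descFactorial_succ]
      calc (t - s) * t.descFactorial s * n ^ (s + 1)
          = ((t - s) * n) * (t.descFactorial s * n ^ s) := by ring
        _ ≤ (t * (n - s)) * (t ^ s * n.descFactorial s) := Nat.mul_le_mul h1 ih
        _ = _ := by ring
  rw [Nat.descFactorial_eq_factorial_mul_choose, Nat.descFactorial_eq_factorial_mul_choose] at key
  refine Nat.le_of_mul_le_mul_left ?_ s.factorial_pos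
  linarith

open Finset in
theorem card_perm_mapsTo_mul_pow_le {α : Type*} [Fintype α] [DecidableEq α] (S T : Finset α) :
    #{σ : Equiv.Perm α | ∀ x ∈ S, σ x ∈ T} * Fintype.card α ^ #S ≤
      #T ^ #S * (Fintype.card α).factorial := by
  set c := #{σ : Equiv.Perm α | S.image σ = S}
  have htot : (Fintype.card α).factorial = (Fintype.card α).choose #S * c := by
    rw [← Fintype.card_perm, ← Finset.card_univ,
      Finset.card_eq_sum_card_fiberwise (f := fun σ : Equiv.Perm α => S.image σ)
        (t := powersetCard #S univ)]
    · rw [Finset.sum_congr rfl fun S' hS' => card_perm_image_eq S S' (mem_powersetCard.1 hS').2]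
      simp [c]
    · intro σ _
      simp [Finset.card_image_of_injective _ σ.injective]
  have hbad : #{σ : Equiv.Perm α | ∀ x ∈ S, σ x ∈ T} ≤ (#T).choose #S * c := by
    rw [Finset.card_eq_sum_card_fiberwise (f := fun σ : Equiv.Perm α => S.image σ)
        (t := powersetCard #S T), ← Finset.card_powersetCard, ← smul_eq_mul, ← Finset.sum_const]
    · refine Finset.sum_le_sum fun S' hS' => ?_
      refine le_trans ?_ (card_perm_image_eq S S' (mem_powersetCard.1 hS').2).le
      exact Finset.card_le_card fun σ hσ => by simp_all
    · intro σ hσ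
      simp only [mem_coe, mem_powersetCard, image_subset_iff,
        Finset.card_image_of_injective _ σ.injective, and_true]
      exact (mem_filter.1 hσ).2
  calc _ ≤ (#T).choose #S * c * Fintype.card α ^ #S := Nat.mul_le_mul_right _ hbad
    _ = (#T).choose #S * Fintype.card α ^ #S * c := by ring
    _ ≤ #T ^ #S * (Fintype.card α).choose #S * c :=
        Nat.mul_le_mul_right _ (choose_mul_pow_le (Finset.card_le_univ T) _)
    _ = _ := by rw [htot]; ring

theorem choose_mul_self_pow_le (n s : ℕ) : (n.choose s : ℝ) * (s : ℝ) ^ s ≤ (3 * n) ^ s := by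
  have h1 : (n.choose s : ℝ) ≤ (n : ℝ) ^ s / s.factorial := Nat.choose_le_pow_div s n
  have h2 : (s : ℝ) ^ s / s.factorial ≤ 3 ^ s := by
    refine (Real.pow_div_factorial_le_exp _ (Nat.cast_nonneg s) s).trans ?_
    rw [← Real.exp_one_pow]
    exact pow_le_pow_left₀ (Real.exp_pos 1).le Real.exp_one_lt_three.le s
  calc (n.choose s : ℝ) * (s : ℝ) ^ s ≤ (n : ℝ) ^ s / s.factorial * (s : ℝ) ^ s := by gcongr
    _ = (n : ℝ) ^ s * ((s : ℝ) ^ s / s.factorial) := by ring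
    _ ≤ (n : ℝ) ^ s * 3 ^ s := by gcongr
    _ = _ := by rw [mul_pow, mul_comm]

theorem choose_mul_choose_mul_pow_le {m s : ℕ} (hm : 10 ≤ m) (hs : 2 * s ≤ 3 * m + 2) :
    ((4 * m).choose s : ℝ) * ((2 * m).choose s) * (((s : ℝ) / (2 * m)) ^ s) ^ 20 ≤ (1 / 2) ^ s := by
  have hm0 : (10 : ℝ) ≤ m := by exact_mod_cast hm
  have hm' : (0 : ℝ) < 2 * m := by linarith
  set q : ℝ := (s : ℝ) / (2 * m) with hq
  have hq0 : 0 ≤ q := by positivity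
  have hq1 : q ≤ 4 / 5 := by
    have : (2 * s : ℝ) ≤ 3 * m + 2 := by exact_mod_cast hs
    rw [hq, div_le_iff₀ hm']
    linarith
  have h1 : ((4 * m).choose s : ℝ) * q ^ s ≤ 6 ^ s := by
    have := choose_mul_self_pow_le (4 * m) s
    rw [hq, div_pow, ← mul_div_assoc, div_le_iff₀ (by positivity), ← mul_pow]
    refine this.trans_eq ?_
    push_cast; ring
  have h2 : ((2 * m).choose s : ℝ) * q ^ s ≤ 3 ^ s := by
    have := choose_mul_self_pow_le (2 * m) s
    rw [hq, div_pow, ← mul_div_assoc, div_le_iff₀ (by positivity), ← mul_pow]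
    refine this.trans_eq ?_
    push_cast; ring
  calc ((4 * m).choose s : ℝ) * ((2 * m).choose s) * (q ^ s) ^ 20
      = (((4 * m).choose s : ℝ) * q ^ s) * (((2 * m).choose s) * q ^ s) * (q ^ s) ^ 18 := by ring
    _ ≤ 6 ^ s * 3 ^ s * (q ^ s) ^ 18 := by gcongr
    _ = (6 * 3 * q ^ 18) ^ s := by rw [mul_pow, mul_pow, ← pow_mul, ← pow_mul, mul_comm s 18]
    _ ≤ (6 * 3 * (4 / 5) ^ 18) ^ s := by gcongr
    _ ≤ _ := by
      refine pow_le_pow_left₀ (by norm_num) (by norm_num) s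

/-- The number of ways to pick 20 permutations of a `4m`-set, all of which send `S` into the
preimage of `T` under the two-to-one map onto a `2m`-set. -/
theorem card_perms_mapsTo_le {m : ℕ} (hm : 0 < m) (S : Finset (Fin (2 * m) ⊕ Fin (2 * m)))
    (T : Finset (Fin (2 * m))) (h : T.card = S.card) :
    ((Finset.univ.filter fun f : Fin 20 → Equiv.Perm (Fin (2 * m) ⊕ Fin (2 * m)) =>
      ∀ j, ∀ x ∈ S, Sum.elim id id (f j x) ∈ T).card : ℝ) ≤
      (((S.card : ℝ) / (2 * m)) ^ S.card) ^ 20 * ((4 * m).factorial : ℝ) ^ 20 := by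
  have hT : (Finset.univ.filter fun y : Fin (2 * m) ⊕ Fin (2 * m) =>
      Sum.elim id id y ∈ T) = T.disjSum T := by
    ext (y | y) <;> simp
  have hcard : Fintype.card (Fin (2 * m) ⊕ Fin (2 * m)) = 4 * m := by simp; ring
  have h1 := card_perm_mapsTo_mul_pow_le S (T.disjSum T)
  rw [hcard, Finset.card_disjSum, h] at h1
  have h2 : (Finset.univ.filter fun f : Fin 20 → Equiv.Perm (Fin (2 * m) ⊕ Fin (2 * m)) =>
      ∀ j, ∀ x ∈ S, Sum.elim id id (f j x) ∈ T) = Fintype.piFinset fun _ =>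
        Finset.univ.filter fun σ => ∀ x ∈ S, σ x ∈ T.disjSum T := by
    ext f
    simp [← hT]
  rw [h2, Fintype.card_piFinset_const]
  push_cast
  rw [← mul_pow]
  refine pow_le_pow_left₀ (by positivity) ?_ 20
  have hm' : (0 : ℝ) < m := by exact_mod_cast hm
  have h3 : ((Finset.univ.filter fun σ : Equiv.Perm (Fin (2 * m) ⊕ Fin (2 * m)) =>
      ∀ x ∈ S, σ x ∈ T.disjSum T).card : ℝ) * (4 * m) ^ S.card ≤
        (S.card + S.card) ^ S.card * ((4 * m).factorial : ℝ) := by exact_mod_cast h1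
  rw [← le_div_iff₀ (by positivity)] at h3
  refine h3.trans (le_of_eq ?_)
  rw [mul_div_right_comm, ← div_pow]
  congr 2
  field_simp
  ring

open Finset in
theorem exists_expander {m : ℕ} (hm : 10 ≤ m) :
    ∃ N : Fin (2 * m) ⊕ Fin (2 * m) → Finset (Fin (2 * m)),
      (∀ x, #(N x) ≤ 20) ∧ (∀ y, #{x | y ∈ N x} ≤ 40) ∧
      ∀ S : Finset (Fin (2 * m) ⊕ Fin (2 * m)), 2 * #S ≤ 3 * m + 2 → #S ≤ #(S.biUnion N) := by
  let V := Fin (2 * m) ⊕ Fin (2 * m)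
  let bad (S : Finset V) (T : Finset (Fin (2 * m))) : Finset (Fin 20 → Equiv.Perm V) :=
    univ.filter fun f => ∀ j, ∀ x ∈ S, Sum.elim id id (f j x) ∈ T
  let k := (3 * m + 2) / 2
  let allBad : Finset (Fin 20 → Equiv.Perm V) := (Icc 1 k).biUnion fun s =>
    (powersetCard s univ).biUnion fun S => (powersetCard s univ).biUnion fun T => bad S T
  have hcard : Fintype.card V = 4 * m := by simp [V]; ring
  have hF : (0 : ℝ) < ((4 * m).factorial : ℝ) ^ 20 := by positivity
  have hlt : #allBad < Fintype.card (Fin 20 → Equiv.Perm V) := by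
    have h1 : (#allBad : ℝ) ≤ ∑ s ∈ Icc 1 k, (1 / 2 : ℝ) ^ s * ((4 * m).factorial : ℝ) ^ 20 := by
      refine (Nat.cast_le.2 card_biUnion_le).trans ?_
      push_cast
      refine sum_le_sum fun s hs => ?_
      have hs2 : 2 * s ≤ 3 * m + 2 := by
        have := (mem_Icc.1 hs).2
        omega
      refine (Nat.cast_le.2 card_biUnion_le).trans ?_
      push_cast
      refine (sum_le_sum (g := fun _ => ((2 * m).choose s : ℝ) * ((((s : ℝ) / (2 * m)) ^ s) ^ 20 *
        ((4 * m).factorial : ℝ) ^ 20)) fun S hS => ?_).trans ?_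
      · refine (Nat.cast_le.2 card_biUnion_le).trans ?_
        push_cast
        have hS' := (mem_powersetCard.1 hS).2
        refine (sum_le_sum (g := fun _ => (((s : ℝ) / (2 * m)) ^ s) ^ 20 *
          ((4 * m).factorial : ℝ) ^ 20) fun T hT => ?_).trans ?_
        · have := card_perms_mapsTo_le (by omega) S T ((mem_powersetCard.1 hT).2.trans hS'.symm)
          rwa [hS'] at this
        · simp
      · rw [sum_const, card_powersetCard, card_univ, hcard, nsmul_eq_mul, ← mul_assoc, ← mul_assoc]
        exact mul_le_mul_of_nonneg_right (choose_mul_choose_mul_pow_le hm hs2) hF.le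
    have h2 : ∑ s ∈ Icc 1 k, (1 / 2 : ℝ) ^ s < 1 := by
      have : ∀ k, ∑ s ∈ Icc 1 k, (1 / 2 : ℝ) ^ s = 1 - (1 / 2) ^ k := by
        intro k
        induction k with
        | zero => simp
        | succ k ih => rw [sum_Icc_succ_top (by omega), ih]; ring
      rw [this]
      have : (0 : ℝ) < (1 / 2) ^ k := by positivity
      linarith
    have h3 : (#allBad : ℝ) < ((4 * m).factorial : ℝ) ^ 20 := by
      rw [← sum_mul] at h1
      exact h1.trans_lt (by nlinarith)
    rw [Fintype.card_fun, Fintype.card_perm, hcard, Fintype.card_fin]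
    exact_mod_cast h3
  obtain ⟨f, hf⟩ : ∃ f, f ∉ allBad := by
    by_contra! h
    rw [(eq_univ_iff_forall).2 h, card_univ] at hlt
    exact lt_irrefl _ hlt
  refine ⟨fun x => univ.image fun j => Sum.elim id id (f j x), fun x => ?_, fun y => ?_,
    fun S hS => ?_⟩
  · exact card_image_le.trans (by simp)
  · calc _ ≤ #((univ : Finset (Fin 20 × Bool)).image fun p =>
            (f p.1).symm (bif p.2 then Sum.inl y else Sum.inr y)) := by
          refine card_le_card fun x hx => ?_
          obtain ⟨j, -, hj⟩ := mem_image.1 (mem_filter.1 hx).2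
          rw [mem_image]
          cases h : f j x with
          | inl z =>
            refine ⟨(j, true), mem_univ _, ?_⟩
            simp_all [Equiv.symm_apply_eq]
          | inr z =>
            refine ⟨(j, false), mem_univ _, ?_⟩
            simp_all [Equiv.symm_apply_eq]
      _ ≤ 40 := card_image_le.trans (by simp)
  · by_contra! hlt
    have hSle : #S ≤ #(univ : Finset (Fin (2 * m))) := by simp; omega
    obtain ⟨T, hT, hTc⟩ := exists_superset_card_eq hlt.le (by simpa using hSle)
    refine hf ?_
    simp only [allBad, mem_biUnion, mem_Icc, mem_powersetCard]
    refine ⟨#S, ⟨by omega, by omega⟩, S, ⟨subset_univ _, rfl⟩, T, ⟨subset_univ _, hTc⟩, ?_⟩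
    refine mem_filter.2 ⟨mem_univ _, fun j x hx => hT ?_⟩
    exact mem_biUnion.2 ⟨x, hx, mem_image_of_mem _ (mem_univ j)⟩

open Finset in
/-- A bipartite graph of bounded degree with parts of sizes `3m` and `4m` which stays perfectly
matchable after the deletion of any `m` vertices of a fixed `2m`-subset of the second part. -/
theorem exists_robustly_matchable {m : ℕ} (hm : 10 ≤ m) :
    ∃ N : Fin (3 * m) → Finset (Fin (2 * m) ⊕ Fin (2 * m)),
      (∀ u, #(N u) ≤ 60) ∧ (∀ v, #{u | v ∈ N u} ≤ 60) ∧
      ∀ Z : Finset (Fin (2 * m)), #Z = m →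
        ∃ f : Fin (3 * m) → Fin (2 * m) ⊕ Fin (2 * m), Function.Injective f ∧
          (∀ u, f u ∈ N u) ∧ ∀ v, v ∈ Set.range f ↔ ∀ i ∈ Z, v ≠ Sum.inl i := by
  obtain ⟨K, hK1, hK2, hK⟩ := exists_expander hm
  obtain ⟨ι⟩ : Nonempty (Fin (3 * m) ↪ Fin (2 * m) ⊕ Fin (2 * m)) :=
    Function.Embedding.nonempty_of_card_le (by simp; omega)
  let κ : Fin (2 * m) ↪ Fin (3 * m) := Fin.castLEEmb (by omega)
  let N (u : Fin (3 * m)) : Finset (Fin (2 * m) ⊕ Fin (2 * m)) :=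
    (K (ι u)).map .inr ∪ univ.filter fun v => ∃ r ∈ K v, κ r = u
  refine ⟨N, fun u => ?_, fun v => ?_, fun Z hZ => ?_⟩
  · refine (card_union_le _ _).trans (add_le_add (b := 20) (d := 40) (by simpa using hK1 _) ?_)
    by_cases hu : ∃ r, κ r = u
    · obtain ⟨r, rfl⟩ := hu
      simpa using hK2 r
    · push Not at hu
      simp [hu]
  · calc #{u | v ∈ N u} ≤ #((univ.filter fun u => ∃ w, v = Sum.inr w ∧ w ∈ K (ι u)) ∪
            (K v).map κ) := by
          refine card_le_card fun u hu => ?_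
          simp only [N, mem_filter, mem_univ, true_and, mem_union, mem_map] at hu ⊢
          rcases hu with ⟨w, hw, rfl⟩ | h
          · exact .inl ⟨w, rfl, hw⟩
          · exact .inr h
      _ ≤ 40 + 20 := by
          refine (card_union_le _ _).trans (add_le_add ?_ (by simpa using hK1 v))
          rcases v with v | w
          · simp
          · refine le_trans ?_ (hK2 w)
            rw [← card_map ι]
            refine card_le_card fun x hx => ?_
            obtain ⟨u, hu, rfl⟩ := mem_map.1 hx
            simpa using hu
  have hall : ∀ S : Finset (Fin (3 * m)), #S ≤ #(S.biUnion fun u => N u \ Z.map .inl) := by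
    intro S
    by_cases hS : 2 * #S ≤ 3 * m
    · have h1 := hK (S.map ι) (by simpa using hS.trans (by omega))
      rw [card_map] at h1
      refine (h1.trans_eq (card_map .inr).symm).trans (card_le_card fun v hv => ?_)
      obtain ⟨w, hw, rfl⟩ := mem_map.1 hv
      obtain ⟨x, hx, hwx⟩ := mem_biUnion.1 hw
      obtain ⟨u, hu, rfl⟩ := mem_map.1 hx
      refine mem_biUnion.2 ⟨u, hu, ?_⟩
      simp [N, hwx]
    · by_contra! hlt
      set P := S.biUnion fun u => N u \ Z.map .inl
      have hT : 3 * m - #S + 1 ≤ #((P ∪ Z.map .inl)ᶜ) := by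
        have h1 : #(P ∪ Z.map .inl) ≤ #P + m := by
          refine (card_union_le _ _).trans ?_
          simp [hZ]
        rw [card_compl]
        simp only [Fintype.card_sum, Fintype.card_fin]
        have : #S ≤ 3 * m := by simpa using card_le_univ S
        omega
      obtain ⟨T, hTs, hTc⟩ := exists_subset_card_eq hT
      have h2 := hK T (by omega)
      have h3 : (T.biUnion K).map κ ⊆ Sᶜ := by
        intro u hu
        obtain ⟨r, hr, rfl⟩ := mem_map.1 hu
        obtain ⟨v, hv, hrv⟩ := mem_biUnion.1 hr
        rw [mem_compl]
        intro hS
        have hv' := hTs hv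
        rw [mem_compl, mem_union, not_or] at hv'
        refine hv'.1 (mem_biUnion.2 ⟨κ r, hS, mem_sdiff.2 ⟨?_, hv'.2⟩⟩)
        refine mem_union_right _ (mem_filter.2 ⟨mem_univ _, r, hrv, rfl⟩)
      have h4 := card_le_card h3
      rw [card_map, card_compl, Fintype.card_fin] at h4
      omega
  obtain ⟨f, hf, hfN⟩ := (all_card_le_biUnion_card_iff_exists_injective _).1 hall
  have himg : univ.image f = (Z.map .inl)ᶜ := by
    refine eq_of_subset_of_card_le (fun v hv => ?_) ?_
    · obtain ⟨u, -, rfl⟩ := mem_image.1 hv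
      exact mem_compl.2 (mem_sdiff.1 (hfN u)).2
    · rw [card_image_of_injective _ hf, card_compl, card_map, hZ]
      simp; omega
  refine ⟨f, hf, fun u => (mem_sdiff.1 (hfN u)).1, fun v => ?_⟩
  have := congrArg (v ∈ ·) himg
  simpa [eq_comm] using this

open Finset in
/-- A bipartite graph of small maximum degree between two copies of a large set extends to a
`d`-regular one. -/
theorem exists_regular_superset {α : Type*} [Fintype α] [DecidableEq α] {d e : ℕ}
    (G₀ : Finset (α × α)) (hl : ∀ a, #{p ∈ G₀ | p.1 = a} ≤ e) (hr : ∀ b, #{p ∈ G₀ | p.2 = b} ≤ e)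
    (hed : e < d) (hn : 3 * d * d < Fintype.card α) :
    ∃ G, G₀ ⊆ G ∧ (∀ a, #{p ∈ G | p.1 = a} = d) ∧ ∀ b, #{p ∈ G | p.2 = b} = d := by
  let good : Finset (Finset (α × α)) := univ.filter fun G =>
    G₀ ⊆ G ∧ (∀ a, #{p ∈ G | p.1 = a} ≤ d) ∧ ∀ b, #{p ∈ G | p.2 = b} ≤ d
  have hgood : ∀ {G}, G ∈ good ↔
      G₀ ⊆ G ∧ (∀ a, #{p ∈ G | p.1 = a} ≤ d) ∧ ∀ b, #{p ∈ G | p.2 = b} ≤ d := by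
    simp [good]
  obtain ⟨G, hG, hmax⟩ := exists_max_image good card
    ⟨G₀, hgood.2 ⟨Subset.rfl, fun a => (hl a).trans hed.le, fun b => (hr b).trans hed.le⟩⟩
  obtain ⟨hG0, hGl, hGr⟩ := hgood.1 hG
  have hsl : ∀ F : Finset (α × α), #F = ∑ a, #{p ∈ F | p.1 = a} := fun F =>
    card_eq_sum_card_fiberwise (fun _ _ => mem_coe.2 (mem_univ _))
  have hsr : ∀ F : Finset (α × α), #F = ∑ b, #{p ∈ F | p.2 = b} := fun F =>
    card_eq_sum_card_fiberwise (fun _ _ => mem_coe.2 (mem_univ _))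
  have hadj : ∀ u v, #{p ∈ G | p.1 = u} < d → #{p ∈ G | p.2 = v} < d → (u, v) ∈ G := by
    intro u v hu hv
    by_contra huv
    have := hmax (insert (u, v) G) (hgood.2 ⟨hG0.trans (subset_insert _ _), fun a => ?_, fun b => ?_⟩)
    · rw [card_insert_of_notMem huv] at this
      omega
    · rw [filter_insert]
      split_ifs with h
      · subst h
        exact (card_insert_le _ _).trans hu
      · exact hGl a
    · rw [filter_insert]
      split_ifs with h
      · subst h
        exact (card_insert_le _ _).trans hv
      · exact hGr b
  have hfull : ¬ #G < d * Fintype.card α := by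
    intro hlt
    obtain ⟨u, hu⟩ : ∃ u, #{p ∈ G | p.1 = u} < d := by
      by_contra! h
      have := (hsl G).symm ▸ card_nsmul_le_sum univ _ d fun a _ => h a
      simp only [card_univ, smul_eq_mul] at this
      linarith
    obtain ⟨v, hv⟩ : ∃ v, #{p ∈ G | p.2 = v} < d := by
      by_contra! h
      have := (hsr G).symm ▸ card_nsmul_le_sum univ _ d fun a _ => h a
      simp only [card_univ, smul_eq_mul] at this
      linarith
    let Nu : Finset α := (G.filter fun p => p.1 = u).image Prod.snd
    let Nv : Finset α := (G.filter fun p => p.2 = v).image Prod.fst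
    have hNu : #Nu ≤ d := card_image_le.trans hu.le
    have hNv : #Nv ≤ d := card_image_le.trans hv.le
    have hcardG : d * (Fintype.card α - d) ≤ #G := by
      calc d * (Fintype.card α - d) ≤ d * #Nvᶜ := by
            rw [card_compl]; gcongr
        _ = ∑ a ∈ Nvᶜ, d := by simp [mul_comm]
        _ ≤ ∑ a ∈ Nvᶜ, #{p ∈ G | p.1 = a} := by
            refine sum_le_sum fun a ha => ?_
            by_contra! h
            exact mem_compl.1 ha (mem_image.2 ⟨(a, v), mem_filter.2 ⟨hadj a v h hv, rfl⟩, rfl⟩)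
        _ ≤ ∑ a, #{p ∈ G | p.1 = a} := sum_le_sum_of_subset (subset_univ _)
        _ = #G := (hsl G).symm
    have hcardG0 : #G₀ ≤ e * Fintype.card α := by
      rw [hsl G₀]
      refine (sum_le_card_nsmul univ _ e fun a _ => hl a).trans ?_
      simp [mul_comm]
    let B₁ : Finset (α × α) := G.filter fun p => p.2 ∈ Nu
    let B₂ : Finset (α × α) := G.filter fun p => p.1 ∈ Nv
    have hB₁ : #B₁ ≤ d * d := by
      refine (card_le_mul_card_image_of_maps_to (s := B₁) (t := Nu) (f := Prod.snd)
        (fun p hp => (mem_filter.1 hp).2) d fun b _ => ?_).trans (Nat.mul_le_mul_left _ hNu)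
      exact (card_le_card (filter_subset_filter _ (filter_subset _ _))).trans (hGr b)
    have hB₂ : #B₂ ≤ d * d := by
      refine (card_le_mul_card_image_of_maps_to (s := B₂) (t := Nv) (f := Prod.fst)
        (fun p hp => (mem_filter.1 hp).2) d fun b _ => ?_).trans (Nat.mul_le_mul_left _ hNv)
      exact (card_le_card (filter_subset_filter _ (filter_subset _ _))).trans (hGl b)
    obtain ⟨⟨a, b⟩, hab, hab'⟩ : ∃ p ∈ G, p ∉ G₀ ∪ (B₁ ∪ B₂) := by
      by_contra! h
      have h1 : #G ≤ #G₀ + (#B₁ + #B₂) := (card_le_card h).trans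
        ((card_union_le _ _).trans (Nat.add_le_add_left (card_union_le _ _) _))
      rw [Nat.mul_sub] at hcardG
      have h2 : (e + 1) * Fintype.card α ≤ d * Fintype.card α := Nat.mul_le_mul_right _ hed
      rw [add_mul, one_mul] at h2
      have h3 : 3 * d * d = d * d + d * d + d * d := by ring
      omega
    simp only [mem_union, not_or, B₁, B₂, mem_filter, hab, true_and] at hab'
    obtain ⟨hab0, hb, ha⟩ := hab'
    have hub : (u, b) ∉ G := fun h => hb (mem_image.2 ⟨(u, b), mem_filter.2 ⟨h, rfl⟩, rfl⟩)
    have hav : (a, v) ∉ G := fun h => ha (mem_image.2 ⟨(a, v), mem_filter.2 ⟨h, rfl⟩, rfl⟩)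
    have hau : a ≠ u := fun h => hub (h ▸ hab)
    have hbv : b ≠ v := fun h => hav (h ▸ hab)
    have h1 : (a, v) ∉ G.erase (a, b) := fun h => hav (mem_of_mem_erase h)
    have h2 : (u, b) ∉ insert (a, v) (G.erase (a, b)) := by
      simp [hau.symm, hub]
    have := hmax (insert (u, b) (insert (a, v) (G.erase (a, b))))
      (hgood.2 ⟨fun p hp => ?_, fun x => ?_, fun y => ?_⟩)
    · rw [card_insert_of_notMem h2, card_insert_of_notMem h1, card_erase_of_mem hab] at this
      have := card_pos.2 ⟨_, hab⟩
      omega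
    · refine mem_insert_of_mem (mem_insert_of_mem (mem_erase.2 ⟨?_, hG0 hp⟩))
      rintro rfl
      exact hab0 hp
    · rw [filter_insert, filter_insert, filter_erase]
      by_cases hxa : a = x
      · subst hxa
        rw [if_neg hau.symm, if_pos rfl]
        refine (card_insert_le _ _).trans ?_
        have hm : (a, b) ∈ G.filter fun p => p.1 = a := mem_filter.2 ⟨hab, rfl⟩
        rw [card_erase_add_one hm]
        exact hGl a
      · rw [if_neg hxa]
        split_ifs with h
        · subst h
          exact (card_insert_le _ _).trans (Nat.succ_le_of_lt (card_erase_le.trans_lt hu))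
        · exact card_erase_le.trans (hGl x)
    · rw [filter_insert, filter_insert, filter_erase]
      by_cases hyb : b = y
      · subst hyb
        rw [if_pos rfl, if_neg hbv.symm]
        refine (card_insert_le _ _).trans ?_
        have hm : (a, b) ∈ G.filter fun p => p.2 = b := mem_filter.2 ⟨hab, rfl⟩
        rw [card_erase_add_one hm]
        exact hGr b
      · rw [if_neg hyb]
        split_ifs with h
        · subst h
          exact (card_insert_le _ _).trans (Nat.succ_le_of_lt (card_erase_le.trans_lt hv))
        · exact card_erase_le.trans (hGr y)
  refine ⟨G, hG0, fun a => ?_, fun b => ?_⟩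
  · refine (hGl a).antisymm ?_
    by_contra! h
    refine hfull ?_
    rw [hsl G]
    refine (sum_lt_sum (fun a _ => hGl a) ⟨a, mem_univ a, h⟩).trans_le ?_
    simp [mul_comm]
  · refine (hGr b).antisymm ?_
    by_contra! h
    refine hfull ?_
    rw [hsr G]
    refine (sum_lt_sum (fun a _ => hGr a) ⟨b, mem_univ b, h⟩).trans_le ?_
    simp [mul_comm]

/-- The relation joining `U` to `V` by `R` and `V` to `U` by its transpose, and joining `v ∈ V`
to `w ∈ V` when `D v w`. -/
def gluedRel {U V : Type*} (R R' : U → V → Prop) (D : V → V → Prop) : U ⊕ V → U ⊕ V → Prop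
  | .inl _, .inl _ => False
  | .inl u, .inr v => R u v
  | .inr v, .inl u => R' u v
  | .inr v, .inr w => D v w

section gluedRel

variable {U V : Type*} {R R' : U → V → Prop} {D : V → V → Prop}

@[simp] theorem gluedRel_inl_inl (u u' : U) : gluedRel R R' D (.inl u) (.inl u') ↔ False := Iff.rfl

@[simp] theorem gluedRel_inl_inr (u : U) (v : V) :
    gluedRel R R' D (.inl u) (.inr v) ↔ R u v := Iff.rfl

@[simp] theorem gluedRel_inr_inl (u : U) (v : V) :
    gluedRel R R' D (.inr v) (.inl u) ↔ R' u v := Iff.rfl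

@[simp] theorem gluedRel_inr_inr (v w : V) : gluedRel R R' D (.inr v) (.inr w) ↔ D v w := Iff.rfl

end gluedRel

theorem gluedRel_flip {U V : Type*} {R R' : U → V → Prop} {D : V → V → Prop}
    (hD : ∀ v w, D v w → D w v) (a b : U ⊕ V) :
    gluedRel R R' D a b ↔ gluedRel R' R D b a := by
  rcases a with a | a <;> rcases b with b | b <;> simp only [gluedRel_inl_inl, gluedRel_inl_inr,
    gluedRel_inr_inl, gluedRel_inr_inr]
  exact ⟨hD _ _, hD _ _⟩

open Finset in
theorem card_gluedRel_le {U V : Type*} [Fintype U] [Fintype V] [DecidableEq V]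
    (N : U → Finset V) {k : ℕ} (hU : ∀ u, #(N u) ≤ k) (hV : ∀ v, #{u | v ∈ N u} + 1 ≤ k)
    [DecidableRel (gluedRel (fun u v => v ∈ N u) (fun u v => v ∈ N u) Eq)] (a : U ⊕ V) :
    #{b | gluedRel (fun u v => v ∈ N u) (fun u v => v ∈ N u) Eq a b} ≤ k := by
  rcases a with u | v
  · refine le_of_eq_of_le ?_ (hU u)
    rw [← card_map (Function.Embedding.inr : V ↪ U ⊕ V)]
    congr 1
    ext (b | b) <;> simp
  · refine le_of_eq_of_le ?_ (hV v)
    rw [← card_singleton v, ← card_disjSum]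
    congr 1
    ext (b | b) <;> simp [eq_comm]

theorem existsUnique_gluedRel {U W : Type*} [DecidableEq W] {X Y I : Finset W}
    {f g : U → W ⊕ W} (hIY : ∀ i ∈ I, i ∉ Y)
    (hfr : ∀ v, v ∈ Set.range f ↔ ∀ i ∈ Y ∪ I, v ≠ Sum.inl i)
    (hg : Function.Injective g) (hgr : ∀ v, v ∈ Set.range g ↔ ∀ i ∈ X ∪ I, v ≠ Sum.inl i)
    (a : U ⊕ (W ⊕ W)) (ha : ∀ i ∈ X, a ≠ .inr (.inl i)) :
    ∃! b, gluedRel (fun u v => f u = v) (fun u v => g u = v)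
      (fun v w => v = w ∧ ∃ i ∈ I, v = .inl i) a b ∧ ∀ i ∈ Y, b ≠ .inr (.inl i) := by
  rcases a with u | v
  · refine ⟨.inr (f u), ⟨rfl, fun i hi h => ?_⟩, ?_⟩
    · exact (hfr (f u)).1 ⟨u, rfl⟩ i (Finset.mem_union_left _ hi) (Sum.inr_injective h)
    · rintro (b | b) ⟨hb, -⟩ <;> simp_all
  · by_cases hv : ∃ i ∈ I, v = .inl i
    · refine ⟨.inr v, ⟨⟨rfl, hv⟩, ?_⟩, ?_⟩
      · obtain ⟨i, hi, rfl⟩ := hv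
        rintro j hj h
        simp only [Sum.inr.injEq, Sum.inl.injEq] at h
        exact hIY i hi (h ▸ hj)
      · rintro (b | b) ⟨hb, -⟩
        · obtain ⟨i, hi, rfl⟩ := hv
          exact absurd rfl ((hgr _).1 ⟨b, hb⟩ i (Finset.mem_union_right _ hi))
        · exact congrArg _ hb.1.symm
    · obtain ⟨u, hu⟩ := (hgr v).2 fun i hi h => by
        rcases Finset.mem_union.1 hi with hi | hi
        · exact ha i hi (congrArg _ h)
        · exact hv ⟨i, hi, h⟩
      refine ⟨.inl u, ⟨hu, fun i hi h => by simp at h⟩, ?_⟩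
      rintro (b | b) ⟨hb, -⟩
      · exact congrArg _ (hg (Eq.trans hb hu.symm))
      · exact absurd hb.2 hv

open Finset in
theorem exists_flexible_rel {m : ℕ} (hm : 30000 ≤ m) :
    ∃ E : Fin (3 * m) ⊕ (Fin (2 * m) ⊕ Fin (2 * m)) →
        Fin (3 * m) ⊕ (Fin (2 * m) ⊕ Fin (2 * m)) → Prop,
      (∀ a, {b | E a b}.ncard = 256) ∧ (∀ b, {a | E a b}.ncard = 256) ∧
      ∀ X Y : Finset (Fin (2 * m)), #X = #Y → #X ≤ m →
        ∃ P : Fin (3 * m) ⊕ (Fin (2 * m) ⊕ Fin (2 * m)) →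
            Fin (3 * m) ⊕ (Fin (2 * m) ⊕ Fin (2 * m)) → Prop,
          (∀ a b, P a b → E a b) ∧
          (∀ a, (∀ i ∈ X, a ≠ .inr (.inl i)) →
            ∃! b, P a b ∧ ∀ i ∈ Y, b ≠ .inr (.inl i)) ∧
          (∀ b, (∀ i ∈ Y, b ≠ .inr (.inl i)) →
            ∃! a, P a b ∧ ∀ i ∈ X, a ≠ .inr (.inl i)) := by
  classical
  obtain ⟨N, hN1, hN2, hN⟩ := exists_robustly_matchable (m := m) (by omega)
  let S := Fin (3 * m) ⊕ (Fin (2 * m) ⊕ Fin (2 * m))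
  let R : S → S → Prop := gluedRel (fun u v => v ∈ N u) (fun u v => v ∈ N u) Eq
  have hsymm : ∀ a b, R a b → R b a := fun a b => (gluedRel_flip (fun _ _ => Eq.symm) a b).1
  let G₀ : Finset (S × S) := univ.filter fun p => R p.1 p.2
  have hdeg : ∀ a, #(univ.filter fun b => R a b) ≤ 61 :=
    card_gluedRel_le N (fun u => (hN1 u).trans (by norm_num)) fun v => Nat.succ_le_succ (hN2 v)
  obtain ⟨G, hG0, hG1, hG2⟩ := exists_regular_superset (d := 256) (e := 61) G₀
    (fun a => by
      refine (card_le_card_of_injOn Prod.snd ?_ ?_).trans (hdeg a)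
      · rintro ⟨x, y⟩ h
        simp_all [G₀]
        grind
      · rintro ⟨x, y⟩ h ⟨x', y'⟩ h' hxy
        simp_all)
    (fun b => by
      refine (card_le_card_of_injOn Prod.fst ?_ ?_).trans (hdeg b)
      · rintro ⟨x, y⟩ h
        simp_all [G₀]
        grind
      · rintro ⟨x, y⟩ h ⟨x', y'⟩ h' hxy
        simp_all)
    (by norm_num) (by simp only [Fintype.card_sum, Fintype.card_fin, S]; omega)
  refine ⟨fun a b => (a, b) ∈ G, fun a => ?_, fun b => ?_, fun X Y hXY hX => ?_⟩
  · rw [← hG1 a, ← Set.ncard_coe_finset, ← Set.ncard_image_of_injective _ (Prod.mk_right_injective a)]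
    congr 1
    ext ⟨x, y⟩
    simp
    grind
  · rw [← hG2 b, ← Set.ncard_coe_finset, ← Set.ncard_image_of_injective _ (Prod.mk_left_injective b)]
    congr 1
    ext ⟨x, y⟩
    simp
    grind
  obtain ⟨I, hI, hIc⟩ : ∃ I ⊆ (X ∪ Y)ᶜ, #I = m - #X := by
    refine exists_subset_card_eq ?_
    have := card_union_le X Y
    rw [card_compl, Fintype.card_fin]
    omega
  have hIX : ∀ i ∈ I, i ∉ X := fun i hi h => mem_compl.1 (hI hi) (mem_union_left _ h)
  have hIY : ∀ i ∈ I, i ∉ Y := fun i hi h => mem_compl.1 (hI hi) (mem_union_right _ h)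
  obtain ⟨f, hf, hfN, hfr⟩ := hN (Y ∪ I) (by
    rw [card_union_of_disjoint (disjoint_left.2 fun i h h' => hIY i h' h)]; omega)
  obtain ⟨g, hg, hgN, hgr⟩ := hN (X ∪ I) (by
    rw [card_union_of_disjoint (disjoint_left.2 fun i h h' => hIX i h' h)]; omega)
  refine ⟨gluedRel (fun u v => f u = v) (fun u v => g u = v)
    (fun v w => v = w ∧ ∃ i ∈ I, v = .inl i), fun a b hab => ?_, existsUnique_gluedRel hIY hfr hg hgr,
    fun b hb => ?_⟩
  · refine hG0 (mem_filter.2 ⟨mem_univ _, ?_⟩)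
    rcases a with a | a <;> rcases b with b | b
    · exact hab
    · exact hab ▸ hfN a
    · exact hab ▸ hgN b
    · exact hab.1
  · simpa only [gluedRel_flip (fun v w (h : v = w ∧ ∃ i ∈ I, v = .inl i) => ⟨h.1.symm, h.1 ▸ h.2⟩)
      _ b] using existsUnique_gluedRel hIX hgr hf hfr b hb

/-- The bipartite graph of a relation on `S`, with both parts labelled by `e`. -/
def bipartiteGraph {S T : Type*} (e : S ≃ T) (E : S → S → Prop) : SimpleGraph (T ⊕ T) where
  Adj
    | .inl a, .inr b => E (e.symm a) (e.symm b)
    | .inr b, .inl a => E (e.symm a) (e.symm b)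
    | _, _ => False
  symm := ⟨by rintro (a | a) (b | b) h <;> exact h⟩
  loopless := ⟨by rintro (a | a) h <;> exact h⟩

theorem exists_isPerfectMatching_of_existsUnique {S T : Type*} (e : S ≃ T) {E P : S → S → Prop}
    (hPE : ∀ a b, P a b → E a b) (W : Set (T ⊕ T))
    (hl : ∀ a, .inl (e a) ∈ W → ∃! b, P a b ∧ .inr (e b) ∈ W)
    (hr : ∀ b, .inr (e b) ∈ W → ∃! a, P a b ∧ .inl (e a) ∈ W) :
    ∃ M : SimpleGraph.Subgraph ((bipartiteGraph e E).induce W), M.IsPerfectMatching := by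
  refine ⟨{ verts := Set.univ
            Adj := fun x y => (bipartiteGraph e P).Adj x y
            adj_sub := ?_
            edge_vert := fun _ => Set.mem_univ _
            symm := ⟨fun _ _ h => h.symm⟩ }, ?_⟩
  · rintro ⟨a | a, ha⟩ ⟨b | b, hb⟩ h
    · exact h
    · exact hPE _ _ h
    · exact hPE _ _ h
    · exact h
  · rw [SimpleGraph.Subgraph.isPerfectMatching_iff]
    rintro ⟨a | a, ha⟩
    · obtain ⟨b, ⟨hb, hbW⟩, hu⟩ := hl (e.symm a) (by simpa using ha)
      refine ⟨⟨.inr (e b), hbW⟩, by simpa [bipartiteGraph] using hb, ?_⟩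
      rintro ⟨c | c, hc⟩ h
      · exact h.elim
      · have := hu (e.symm c) ⟨h, by simpa using hc⟩
        simp [← this]
    · obtain ⟨b, ⟨hb, hbW⟩, hu⟩ := hr (e.symm a) (by simpa using ha)
      refine ⟨⟨.inl (e b), hbW⟩, by simpa [bipartiteGraph] using hb, ?_⟩
      rintro ⟨c | c, hc⟩ h
      · have := hu (e.symm c) ⟨h, by simpa using hc⟩
        simp [← this]
      · exact h.elim

/-- For all sufficiently large `m` there is a 256-regular bipartite
graph `H` with parts of size `7m`, with flexible subsets `A'`, `B'` of size `2m` on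
each side, such that deleting any equal-sized sets `X ⊆ A'`, `Y ⊆ B'` with
`|X| = |Y| ≤ m` leaves a graph with a perfect matching. -/
theorem stmt8 :
    ∃ m0 : ℕ, ∀ m : ℕ, m0 ≤ m →
      ∃ (H : SimpleGraph (Fin (7 * m) ⊕ Fin (7 * m)))
        (A' B' : Set (Fin (7 * m) ⊕ Fin (7 * m))),
        (∀ a b, ¬ H.Adj (Sum.inl a) (Sum.inl b)) ∧
        (∀ a b, ¬ H.Adj (Sum.inr a) (Sum.inr b)) ∧
        (∀ x, (H.neighborSet x).ncard = 256) ∧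
        A' ⊆ Set.range Sum.inl ∧ B' ⊆ Set.range Sum.inr ∧
        A'.ncard = 2 * m ∧ B'.ncard = 2 * m ∧
        ∀ X ⊆ A', ∀ Y ⊆ B', X.ncard = Y.ncard → X.ncard ≤ m →
          ∃ M : SimpleGraph.Subgraph (H.induce ((X ∪ Y)ᶜ)), M.IsPerfectMatching := by
  classical
  refine ⟨30000, fun m hm => ?_⟩
  obtain ⟨E, hE1, hE2, hE⟩ := exists_flexible_rel hm
  let e : Fin (3 * m) ⊕ (Fin (2 * m) ⊕ Fin (2 * m)) ≃ Fin (7 * m) :=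
    Fintype.equivFinOfCardEq (by simp; ring)
  let α (i : Fin (2 * m)) : Fin (7 * m) ⊕ Fin (7 * m) := .inl (e (.inr (.inl i)))
  let β (i : Fin (2 * m)) : Fin (7 * m) ⊕ Fin (7 * m) := .inr (e (.inr (.inl i)))
  have hα : Function.Injective α := fun i j h => by simpa [α] using h
  have hβ : Function.Injective β := fun i j h => by simpa [β] using h
  refine ⟨bipartiteGraph e E, Set.range α, Set.range β, fun _ _ => id, fun _ _ => id, ?_, ?_, ?_,
    ?_, ?_, fun X hX Y hY hXY hXm => ?_⟩
  · rintro (a | b)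
    · have : (bipartiteGraph e E).neighborSet (.inl a) =
          (Sum.inr ∘ e) '' {b | E (e.symm a) b} := by
        ext (c | c)
        · simp [bipartiteGraph]
        · simp [bipartiteGraph, ← e.eq_symm_apply]
      rw [this, Set.ncard_image_of_injective _ (Sum.inr_injective.comp e.injective), hE1]
    · have : (bipartiteGraph e E).neighborSet (.inr b) =
          (Sum.inl ∘ e) '' {a | E a (e.symm b)} := by
        ext (c | c)
        · simp [bipartiteGraph, ← e.eq_symm_apply]
        · simp [bipartiteGraph]
      rw [this, Set.ncard_image_of_injective _ (Sum.inl_injective.comp e.injective), hE2]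
  · rintro _ ⟨i, rfl⟩
    exact ⟨_, rfl⟩
  · rintro _ ⟨i, rfl⟩
    exact ⟨_, rfl⟩
  · rw [Set.ncard_range_of_injective hα]; simp
  · rw [Set.ncard_range_of_injective hβ]; simp
  · have hcard : ∀ {γ : Fin (2 * m) → Fin (7 * m) ⊕ Fin (7 * m)}, Function.Injective γ →
        ∀ Z ⊆ Set.range γ, (Finset.univ.filter fun i => γ i ∈ Z).card = Z.ncard := by
      intro γ hγ Z hZ
      rw [← Set.ncard_coe_finset, ← Set.ncard_image_of_injective _ hγ]
      congr 1
      ext z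
      constructor
      · rintro ⟨i, hi, rfl⟩
        simpa using hi
      · intro hz
        obtain ⟨i, rfl⟩ := hZ hz
        exact ⟨i, by simpa using hz, rfl⟩
    obtain ⟨P, hPE, hl, hr⟩ := hE (Finset.univ.filter fun i => α i ∈ X)
      (Finset.univ.filter fun i => β i ∈ Y) (by rw [hcard hα X hX, hcard hβ Y hY, hXY])
      (by rwa [hcard hα X hX])
    have hWl : ∀ a, Sum.inl (e a) ∈ (X ∪ Y)ᶜ ↔
        ∀ i ∈ Finset.univ.filter fun i => α i ∈ X, a ≠ .inr (.inl i) := by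
      intro a
      constructor
      · rintro h i hi rfl
        exact h (.inl (Finset.mem_filter.1 hi).2)
      · rintro h (hx | hy)
        · obtain ⟨i, hi⟩ := hX hx
          refine h i (Finset.mem_filter.2 ⟨Finset.mem_univ _, hi ▸ hx⟩) ?_
          exact (e.injective (Sum.inl_injective hi)).symm
        · obtain ⟨i, hi⟩ := hY hy
          simp [β] at hi
    have hWr : ∀ b, Sum.inr (e b) ∈ (X ∪ Y)ᶜ ↔
        ∀ i ∈ Finset.univ.filter fun i => β i ∈ Y, b ≠ .inr (.inl i) := by
      intro b
      constructor
      · rintro h i hi rfl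
        exact h (.inr (Finset.mem_filter.1 hi).2)
      · rintro h (hx | hy)
        · obtain ⟨i, hi⟩ := hX hx
          simp [α] at hi
        · obtain ⟨i, hi⟩ := hY hy
          refine h i (Finset.mem_filter.2 ⟨Finset.mem_univ _, hi ▸ hy⟩) ?_
          exact (e.injective (Sum.inr_injective hi)).symm
    refine exists_isPerfectMatching_of_existsUnique e hPE _ (fun a ha => ?_) fun b hb => ?_
    · simpa only [hWr] using hl a ((hWl a).1 ha)
    · simpa only [hWl] using hr b ((hWr b).1 hb)
end

section
/- Let d ≥ 1 and let G be an n-vertex d-regular graph. Then the number of ordered 1-factorizations of G (sequences of d pairwise edge-disjoint perfect matchings decomposing E(G)) is at most ∏_{r=1}^{d} (r!)^{n/(2r)}. -/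
open Finset in
/-- If each element of `s` is weighted by the inverse of the size of its fibre under `g`,
the total weight is the number of values that `g` takes. -/
theorem Finset.sum_inv_card_fiber {ι κ : Type*} [DecidableEq κ] (s : Finset ι) (g : ι → κ) :
    ∑ x ∈ s, ((#{y ∈ s | g y = g x} : ℕ) : ℝ)⁻¹ = #(s.image g) := by
  rw [← Finset.sum_fiberwise_of_maps_to (fun x hx => Finset.mem_image_of_mem g hx)]
  rw [Finset.card_eq_sum_ones, Nat.cast_sum]
  refine Finset.sum_congr rfl fun k hk => ?_
  obtain ⟨a, ha, rfl⟩ := Finset.mem_image.1 hk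
  rw [Finset.sum_congr rfl (g := fun _ => ((#{y ∈ s | g y = g a} : ℕ) : ℝ)⁻¹)]
  · have : 0 < #{y ∈ s | g y = g a} := Finset.card_pos.2 ⟨a, by simp [ha]⟩
    rw [Finset.sum_const, nsmul_eq_mul, Nat.cast_one]
    exact mul_inv_cancel₀ (by positivity)
  · intro x hx
    rw [(Finset.mem_filter.1 hx).2]

open Finset in
/-- A form of the concavity of entropy: the entropy of a variable with at most `r` values is at
most `log r`. -/
theorem Finset.card_mul_log_card_le {ι κ : Type*} [DecidableEq κ] (s : Finset ι) (g : ι → κ)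
    (r : ℕ) (hr : #(s.image g) ≤ r) :
    #s * Real.log #s ≤ ∑ x ∈ s, (Real.log r + Real.log #{y ∈ s | g y = g x}) := by
  rcases s.eq_empty_or_nonempty with rfl | hs
  · simp
  have hs0 : (0 : ℝ) < #s := by exact_mod_cast hs.card_pos
  have hr0 : (0 : ℝ) < r := by exact_mod_cast (hs.image g).card_pos.trans_le hr
  have key : ∀ x ∈ s, Real.log #s + (1 - #s / r * ((#{y ∈ s | g y = g x} : ℕ) : ℝ)⁻¹) ≤
      Real.log r + Real.log #{y ∈ s | g y = g x} := by
    intro x hx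
    have ht : (0 : ℝ) < #{y ∈ s | g y = g x} := by
      exact_mod_cast Finset.card_pos.2 ⟨x, by simp [hx]⟩
    have h := Real.one_sub_inv_le_log_of_pos (x := r * #{y ∈ s | g y = g x} / #s) (by positivity)
    rw [Real.log_div (by positivity) hs0.ne', Real.log_mul hr0.ne' ht.ne'] at h
    have e : (r * (#{y ∈ s | g y = g x} : ℝ) / #s)⁻¹ =
        #s / r * (#{y ∈ s | g y = g x} : ℝ)⁻¹ := by
      field_simp
    rw [e] at h
    linarith
  refine le_trans ?_ (Finset.sum_le_sum key)
  rw [Finset.sum_add_distrib, Finset.sum_sub_distrib, ← Finset.mul_sum,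
    Finset.sum_inv_card_fiber]
  simp only [Finset.sum_const, nsmul_eq_mul, mul_one]
  have : (#s : ℝ) / r * #(s.image g) ≤ #s := by
    rw [div_mul_eq_mul_div, div_le_iff₀ hr0]
    gcongr
  linarith

/-- The logarithm of the factor `(r!)^{1/r}` in Brègman's bound. -/
noncomputable def bregmanTerm (r : ℕ) : ℝ := Real.log r.factorial / r

theorem bregmanTerm_nonneg (r : ℕ) : 0 ≤ bregmanTerm r :=
  div_nonneg (Real.log_natCast_nonneg _) r.cast_nonneg

theorem natCast_mul_bregmanTerm (r : ℕ) : r * bregmanTerm r = Real.log r.factorial := by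
  rcases r.eq_zero_or_pos with rfl | hr
  · simp
  · rw [bregmanTerm]
    field_simp

open Finset in
theorem sum_bregmanTerm_erase {α β : Type*} [Fintype α] [DecidableEq α] [DecidableEq β]
    (R : α → Finset β) (e : α ≃ β) (j : α) (hj : e j ∈ R j) :
    Real.log #(R j) + ∑ i ∈ univ.erase j, bregmanTerm #((R j).erase (e i)) =
      Fintype.card α * bregmanTerm #(R j) := by
  have hr : 0 < #(R j) := Finset.card_pos.2 ⟨_, hj⟩
  have hsplit := Finset.sum_filter_add_sum_filter_not (univ.erase j) (fun i => e i ∈ R j)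
    (fun i => bregmanTerm #((R j).erase (e i)))
  have hin : ∀ i ∈ (univ.erase j).filter (fun i => e i ∈ R j),
      bregmanTerm #((R j).erase (e i)) = bregmanTerm (#(R j) - 1) := by
    intro i hi
    rw [Finset.card_erase_of_mem (Finset.mem_filter.1 hi).2]
  have hout : ∀ i ∈ (univ.erase j).filter (fun i => ¬ e i ∈ R j),
      bregmanTerm #((R j).erase (e i)) = bregmanTerm #(R j) := by
    intro i hi
    rw [Finset.erase_eq_of_notMem (Finset.mem_filter.1 hi).2]
  have hcin : #((univ.erase j).filter (fun i => e i ∈ R j)) + 1 = #(R j) := by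
    have : (univ.erase j).filter (fun i => e i ∈ R j) =
        ((R j).map e.symm.toEmbedding).erase j := by
      ext i
      simp
    rw [this, Finset.card_erase_of_mem (by simpa using hj), Finset.card_map]
    omega
  have hc := Finset.card_filter_add_card_filter_not (s := univ.erase j) (fun i => e i ∈ R j)
  have hcard : #(univ.erase j) + 1 = Fintype.card α := by
    rw [Finset.card_erase_of_mem (Finset.mem_univ j), Finset.card_univ]
    have : 0 < Fintype.card α := Fintype.card_pos_iff.2 ⟨j⟩
    omega
  rw [← hsplit, Finset.sum_congr rfl hin, Finset.sum_congr rfl hout, Finset.sum_const,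
    Finset.sum_const, nsmul_eq_mul, nsmul_eq_mul, ← hcard, ← hc]
  generalize #((univ.erase j).filter (fun i => e i ∈ R j)) = a at *
  generalize #((univ.erase j).filter (fun i => ¬ e i ∈ R j)) = b at *
  rw [← hcin, Nat.add_sub_cancel, natCast_mul_bregmanTerm]
  have h1 := natCast_mul_bregmanTerm (a + 1)
  rw [Nat.factorial_succ, Nat.cast_mul, Real.log_mul (by positivity) (by positivity)] at h1
  push_cast at h1 ⊢
  linarith

open Finset in
/-- **Brègman's theorem** (in logarithmic form), by Schrijver's argument. -/
theorem log_card_equiv_le {α β : Type*} [Fintype α] [DecidableEq α] [Fintype β] [DecidableEq β]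
    (R : α → Finset β) :
    Real.log #{e : α ≃ β | ∀ a, e a ∈ R a} ≤ ∑ a, bregmanTerm #(R a) := by
  induction hn : Fintype.card α generalizing α β with
  | zero =>
    have : IsEmpty α := Fintype.card_eq_zero_iff.1 hn
    have hle : #{e : α ≃ β | ∀ a, e a ∈ R a} ≤ 1 :=
      Finset.card_le_one.2 fun e _ e' _ => Equiv.ext fun a => isEmptyElim a
    have := Real.log_nonpos (x := #{e : α ≃ β | ∀ a, e a ∈ R a}) (by positivity)
      (by exact_mod_cast hle)
    simpa using this
  | succ m ih =>
    set s : Finset (α ≃ β) := {e : α ≃ β | ∀ a, e a ∈ R a} with hs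
    rcases s.eq_empty_or_nonempty with h0 | hne
    · rw [h0]
      simpa using Finset.sum_nonneg fun a _ => bregmanTerm_nonneg _
    have hpos : (0 : ℝ) < #s := by exact_mod_cast hne.card_pos
    have hminor : ∀ i, ∀ e ∈ s, Real.log #{e' ∈ s | e' i = e i} ≤
        ∑ j ∈ univ.erase i, bregmanTerm #((R j).erase (e i)) := by
      intro i e he
      have := ih (α := {x // x ≠ i}) (β := {y // y ≠ e i})
        (fun x => (R x).subtype (fun y => y ≠ e i))
        (by rw [Fintype.card_subtype_compl, Fintype.card_subtype_eq, hn]; rfl)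
      have hsum : ∑ x : {x // x ≠ i}, bregmanTerm #((R x).subtype (fun y => y ≠ e i)) =
          ∑ j ∈ univ.erase i, bregmanTerm #((R j).erase (e i)) := by
        rw [Finset.sum_subtype (univ.erase i) (p := fun x => x ≠ i) (by simp)]
        refine Finset.sum_congr rfl fun x _ => ?_
        rw [Finset.card_subtype, Finset.filter_ne']
      rw [hsum] at this
      refine le_trans (Real.log_le_log ?_ ?_) this
      · exact_mod_cast Finset.card_pos.2 ⟨e, by simp [he]⟩
      · norm_cast
        have hiff : ∀ e' ∈ ({e' ∈ s | e' i = e i} : Finset _), ∀ x, x ≠ i ↔ e' x ≠ e i := by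
          intro e' he' x
          rw [← (Finset.mem_filter.1 he').2, e'.injective.ne_iff]
        refine Finset.card_le_card_of_injOn
          (fun e' => if h : ∀ x, x ≠ i ↔ e' x ≠ e i then e'.subtypeEquiv h else
            e.subtypeEquiv (fun x => e.injective.ne_iff.symm)) ?_ ?_
        · intro e' he'
          have h := hiff e' he'
          have hm := (Finset.mem_filter.1 (Finset.mem_filter.1 he').1).2
          simp only [dif_pos h]
          simpa using fun a _ => hm a
        · intro e₁ h₁ e₂ h₂ heq
          simp only [dif_pos (hiff e₁ h₁), dif_pos (hiff e₂ h₂)] at heq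
          ext x
          by_cases hx : x = i
          · rw [hx, (Finset.mem_filter.1 h₁).2, (Finset.mem_filter.1 h₂).2]
          · simpa using congrArg Subtype.val (DFunLike.congr_fun heq ⟨x, hx⟩)
    have hent : ∀ i, #s * Real.log #s ≤ ∑ e ∈ s, (Real.log #(R i) +
        ∑ j ∈ univ.erase i, bregmanTerm #((R j).erase (e i))) := by
      intro i
      refine (Finset.card_mul_log_card_le s (fun e => e i) #(R i) ?_).trans
        (Finset.sum_le_sum fun e he => ?_)
      · refine Finset.card_le_card (Finset.image_subset_iff.2 fun e he => ?_)
        exact (Finset.mem_filter.1 he).2 i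
      · gcongr
        exact hminor i e he
    have htotal := Finset.sum_le_sum fun i (_ : i ∈ (univ : Finset α)) => hent i
    rw [Finset.sum_comm] at htotal
    have hrow : ∀ e ∈ s, ∑ i, (Real.log #(R i) +
        ∑ j ∈ univ.erase i, bregmanTerm #((R j).erase (e i))) =
        Fintype.card α * ∑ j, bregmanTerm #(R j) := by
      intro e he
      rw [Finset.mul_sum, Finset.sum_add_distrib,
        Finset.sum_comm' (t' := univ) (s' := fun j => univ.erase j) (by simp [eq_comm]),
        ← Finset.sum_add_distrib]
      exact Finset.sum_congr rfl fun j _ =>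
        sum_bregmanTerm_erase R e j ((Finset.mem_filter.1 he).2 j)
    rw [Finset.sum_congr rfl hrow, Finset.sum_const, Finset.sum_const, nsmul_eq_mul,
      nsmul_eq_mul, Finset.card_univ, hn] at htotal
    have hm : (0 : ℝ) < ((m + 1 : ℕ) : ℝ) := by positivity
    refine le_of_mul_le_mul_left ?_ (mul_pos hpos hm)
    linarith

/-- The union of two perfect matchings is bipartite. -/
theorem exists_alternating_of_involutive {V : Type*} (σ τ : Equiv.Perm V)
    (hσ : Function.Involutive σ) (hτ : Function.Involutive τ)
    (hσ' : ∀ x, σ x ≠ x) (hτ' : ∀ x, τ x ≠ x) :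
    ∃ c : V → Prop, ∀ x, (c (σ x) ↔ ¬ c x) ∧ (c (τ x) ↔ ¬ c x) := by
  classical
  set ρ : Equiv.Perm V := τ * σ with hρ
  have hσσ : σ * σ = 1 := Equiv.ext hσ
  have hττ : τ * τ = 1 := Equiv.ext hτ
  have hσi : σ⁻¹ = σ := inv_eq_of_mul_eq_one_left hσσ
  have hτi : τ⁻¹ = τ := inv_eq_of_mul_eq_one_left hττ
  have hconj : σ * ρ * σ⁻¹ = ρ⁻¹ := by
    rw [hρ, mul_inv_rev, hσi, hτi]
    simp [mul_assoc, hσσ]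
  have hzconj : ∀ (m : ℤ) x, σ ((ρ ^ m) x) = (ρ ^ (-m)) (σ x) := by
    intro m x
    have : σ * ρ ^ m * σ⁻¹ = ρ ^ (-m) := by rw [← conj_zpow, hconj, inv_zpow, zpow_neg]
    rw [← this]
    simp
  have hnot : ∀ x, ¬ ρ.SameCycle x (σ x) := by
    rintro x ⟨k, hk⟩
    obtain ⟨m, rfl | rfl⟩ := Int.even_or_odd' k
    · apply hσ' ((ρ ^ m) x)
      rw [hzconj, ← hk, ← Equiv.Perm.mul_apply, ← zpow_add]
      congr 2
      ring
    · apply hτ' (σ ((ρ ^ m) x))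
      change ρ ((ρ ^ m) x) = _
      rw [hzconj, ← hk, ← Equiv.Perm.mul_apply, ← Equiv.Perm.mul_apply, ← zpow_add,
        ← zpow_one_add]
      congr 2
      ring
  let q : V → Quotient (Equiv.Perm.SameCycle.setoid ρ) := Quotient.mk _
  have hq : ∀ {x y}, q x = q y ↔ ρ.SameCycle x y := Quotient.eq
  have hqσ : ∀ x y, q x = q y → q (σ x) = q (σ y) := by
    intro x y h
    obtain ⟨k, rfl⟩ := hq.1 h
    exact hq.2 ⟨-k, (hzconj k x).symm⟩
  have hqτ : ∀ x, q (τ x) = q (σ x) := by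
    intro x
    refine hq.2 (Equiv.Perm.SameCycle.symm ?_)
    have : ρ (σ x) = τ x := by simp [hρ, hσ x]
    exact ⟨1, by simpa using this⟩
  have hqστ : ∀ x, q (σ (τ x)) = q x := by
    intro x
    rw [hqσ _ _ (hqτ x), hσ x]
  let : LinearOrder (Quotient (Equiv.Perm.SameCycle.setoid ρ)) := linearOrderOfSTO WellOrderingRel
  have hne : ∀ x, q x ≠ q (σ x) := fun x h => hnot x (hq.1 h)
  refine ⟨fun x => q x < q (σ x), fun x => ⟨?_, ?_⟩⟩
  · change q (σ x) < q (σ (σ x)) ↔ ¬ q x < q (σ x)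
    rw [hσ x, not_lt]
    exact ⟨le_of_lt, fun h => lt_of_le_of_ne h (hne x).symm⟩
  · change q (τ x) < q (σ (τ x)) ↔ ¬ q x < q (σ x)
    rw [hqστ x, hqτ x, not_lt]
    exact ⟨le_of_lt, fun h => lt_of_le_of_ne h (hne x).symm⟩

namespace SimpleGraph

/-- The perfect matchings of `G`, as the involutions moving every vertex to a neighbour. -/
def matchingPerms {V : Type*} (G : SimpleGraph V) : Set (Equiv.Perm V) :=
  {σ | Function.Involutive σ ∧ ∀ x, G.Adj x (σ x)}

open Classical in
/-- The alternating classes of a relation, chosen canonically from the relation alone. -/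
noncomputable def alternatingClass {V : Type*} (H : V → V → Prop) : V → Prop :=
  if h : ∃ c : V → Prop, ∀ x y, H x y → (c y ↔ ¬ c x) then h.choose else fun _ => True

theorem alternatingClass_spec {V : Type*} {G : SimpleGraph V} {σ τ : Equiv.Perm V}
    (hσ : σ ∈ G.matchingPerms) (hτ : τ ∈ G.matchingPerms) (x : V) :
    (alternatingClass (fun x y => σ x = y ∨ τ x = y) (σ x) ↔
      ¬ alternatingClass (fun x y => σ x = y ∨ τ x = y) x) ∧
    (alternatingClass (fun x y => σ x = y ∨ τ x = y) (τ x) ↔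
      ¬ alternatingClass (fun x y => σ x = y ∨ τ x = y) x) := by
  have h : ∃ c : V → Prop, ∀ x y, (σ x = y ∨ τ x = y) → (c y ↔ ¬ c x) := by
    obtain ⟨c, hc⟩ := exists_alternating_of_involutive σ τ hσ.1 hτ.1
      (fun x => (hσ.2 x).ne') (fun x => (hτ.2 x).ne')
    refine ⟨c, ?_⟩
    rintro x y (rfl | rfl)
    · exact (hc x).1
    · exact (hc x).2
  rw [alternatingClass, dif_pos h]
  exact ⟨h.choose_spec _ _ (Or.inl rfl), h.choose_spec _ _ (Or.inr rfl)⟩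

/-- Two perfect matchings are encoded in one permutation along the edges, by orienting
their union. -/
theorem exists_injOn_matchingPerms_prod {V : Type*} (G : SimpleGraph V) :
    ∃ F : Equiv.Perm V × Equiv.Perm V → Equiv.Perm V,
      Set.MapsTo F (G.matchingPerms ×ˢ G.matchingPerms) {π | ∀ x, G.Adj x (π x)} ∧
      Set.InjOn F (G.matchingPerms ×ˢ G.matchingPerms) := by
  classical
  let cls (p : Equiv.Perm V × Equiv.Perm V) : V → Prop :=
    alternatingClass (fun x y => p.1 x = y ∨ p.2 x = y)
  have hex : ∀ p : Equiv.Perm V × Equiv.Perm V, ∃ π : Equiv.Perm V,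
      p ∈ G.matchingPerms ×ˢ G.matchingPerms →
        (∀ x, π x = if cls p x then p.1 x else p.2 x) ∧
        (∀ x, π.symm x = if cls p x then p.2 x else p.1 x) := by
    intro p
    by_cases hp : p ∈ G.matchingPerms ×ˢ G.matchingPerms
    · have hc := alternatingClass_spec hp.1 hp.2
      have h1 := hp.1.1
      have h2 := hp.2.1
      refine ⟨⟨fun x => if cls p x then p.1 x else p.2 x,
        fun x => if cls p x then p.2 x else p.1 x, fun x => ?_, fun x => ?_⟩,
        fun _ => ⟨fun _ => rfl, fun _ => rfl⟩⟩
      all_goals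
        by_cases hx : cls p x
        · have e1 : ¬ cls p (p.1 x) := fun h => (hc x).1.1 h hx
          have e2 : ¬ cls p (p.2 x) := fun h => (hc x).2.1 h hx
          simp [hx, e1, e2, h1 x, h2 x]
        · have e1 : cls p (p.1 x) := (hc x).1.2 hx
          have e2 : cls p (p.2 x) := (hc x).2.2 hx
          simp [hx, e1, e2, h1 x, h2 x]
    · exact ⟨1, fun h => absurd h hp⟩
  choose F hF using hex
  have hrel : ∀ p ∈ G.matchingPerms ×ˢ G.matchingPerms,
      (fun x y => p.1 x = y ∨ p.2 x = y) = fun x y => F p x = y ∨ (F p).symm x = y := by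
    intro p hp
    ext x y
    rw [(hF p hp).1, (hF p hp).2]
    by_cases hx : cls p x
    · simp [hx]
    · simp [hx, or_comm]
  refine ⟨F, fun p hp x => ?_, fun p hp p' hp' h => ?_⟩
  · rw [(hF p hp).1]
    split_ifs
    · exact hp.1.2 x
    · exact hp.2.2 x
  · have hcls : cls p = cls p' := by
      simp only [cls]
      rw [hrel p hp, hrel p' hp', h]
    have e1 := fun x => (hF p hp).1 x
    have e2 := fun x => (hF p hp).2 x
    simp only [h, hcls, (hF p' hp').1, (hF p' hp').2] at e1 e2
    refine Prod.ext (Equiv.ext fun x => ?_) (Equiv.ext fun x => ?_)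
    all_goals
      have e1x := e1 x
      have e2x := e2 x
      by_cases hx : cls p' x
      · simp only [hx, if_true] at e1x e2x
        simp [e1x, e2x]
      · simp only [hx, if_false] at e1x e2x
        simp [e1x, e2x]

open Finset in
/-- The **Kahn–Lovász theorem** for regular graphs. -/
theorem ncard_matchingPerms_le {V : Type*} [Fintype V] (G : SimpleGraph V) (d : ℕ)
    (hreg : ∀ x, (G.neighborSet x).ncard = d) :
    (G.matchingPerms.ncard : ℝ) ≤
      (d.factorial : ℝ) ^ ((Fintype.card V : ℝ) / (2 * (d : ℝ))) := by
  classical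
  rcases Nat.eq_zero_or_pos G.matchingPerms.ncard with h0 | hpos
  · rw [h0]
    simpa using Real.rpow_nonneg (Nat.cast_nonneg _) _
  obtain ⟨F, hF, hFi⟩ := G.exists_injOn_matchingPerms_prod
  have hle : G.matchingPerms.ncard * G.matchingPerms.ncard ≤
      #{e : V ≃ V | ∀ a, e a ∈ G.neighborFinset a} := by
    rw [← Set.ncard_prod, ← Set.ncard_coe_finset]
    refine Set.ncard_le_ncard_of_injOn F (fun p hp => ?_) hFi (Set.toFinite _)
    simpa using hF hp
  have hdeg : ∀ a, #(G.neighborFinset a) = d := by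
    intro a
    rw [← hreg a, ← Set.ncard_coe_finset, coe_neighborFinset]
  have hp : (0 : ℝ) < G.matchingPerms.ncard := by exact_mod_cast hpos
  have hlog : Real.log (G.matchingPerms.ncard * G.matchingPerms.ncard : ℝ) ≤
      Fintype.card V * bregmanTerm d := by
    have hB := log_card_equiv_le (fun a => G.neighborFinset a)
    simp only [hdeg, sum_const, nsmul_eq_mul, card_univ] at hB
    refine le_trans (Real.log_le_log (mul_pos hp hp) ?_) hB
    rw [← Nat.cast_mul]
    exact Nat.cast_le.2 hle
  rw [Real.log_mul hp.ne' hp.ne', bregmanTerm] at hlog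
  rw [← Real.log_le_log_iff hp (by positivity), Real.log_rpow (by positivity)]
  have : (Fintype.card V : ℝ) / (2 * d) * Real.log d.factorial =
      Fintype.card V * (Real.log d.factorial / d) / 2 := by
    ring
  linarith

/-- Tuples of pairwise disjoint perfect matchings, as permutations. -/
def matchingTuples {V : Type*} (G : SimpleGraph V) (k : ℕ) : Set (Fin k → Equiv.Perm V) :=
  {s | (∀ i, s i ∈ G.matchingPerms) ∧ ∀ i j, i ≠ j → ∀ x, s i x ≠ s j x}

/-- The graph left after removing the edges `x — σ x`. -/
def removePerm {V : Type*} (G : SimpleGraph V) (σ : Equiv.Perm V) (hσ : Function.Involutive σ) :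
    SimpleGraph V where
  Adj x y := G.Adj x y ∧ σ x ≠ y
  symm := ⟨fun x y h => ⟨h.1.symm, fun h' => h.2 (by rw [← h', hσ y])⟩⟩
  loopless := ⟨fun x h => G.loopless.irrefl x h.1⟩

theorem ncard_neighborSet_removePerm {V : Type*} [Fintype V] (G : SimpleGraph V)
    {σ : Equiv.Perm V} (hσ : σ ∈ G.matchingPerms) (x : V) :
    ((G.removePerm σ hσ.1).neighborSet x).ncard + 1 = (G.neighborSet x).ncard := by
  have : (G.removePerm σ hσ.1).neighborSet x = G.neighborSet x \ {σ x} := by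
    ext y
    simp [removePerm, eq_comm]
  have hx : σ x ∈ G.neighborSet x := hσ.2 x
  rw [this, Set.ncard_sdiff_singleton_add_one hx (Set.toFinite _)]

theorem ncard_matchingTuples_le {V : Type*} [Fintype V] (d : ℕ) (G : SimpleGraph V)
    (hreg : ∀ x, (G.neighborSet x).ncard = d) :
    ((G.matchingTuples d).ncard : ℝ) ≤
      ∏ r ∈ Finset.Icc 1 d, (Nat.factorial r : ℝ) ^ ((Fintype.card V : ℝ) / (2 * (r : ℝ))) := by
  classical
  induction d generalizing G with
  | zero =>
    have : (G.matchingTuples 0).ncard ≤ 1 :=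
      (Set.ncard_le_one (Set.toFinite _)).2 fun _ _ _ _ => Subsingleton.elim _ _
    simpa using this
  | succ d ih =>
    rw [Finset.prod_Icc_succ_top (by omega)]
    set B := ∏ r ∈ Finset.Icc 1 d,
      (Nat.factorial r : ℝ) ^ ((Fintype.card V : ℝ) / (2 * (r : ℝ)))
    have hB0 : 0 ≤ B := Finset.prod_nonneg fun r _ => by positivity
    have hfib : ∀ σ ∈ G.matchingPerms.toFinset,
        ((Finset.card {s ∈ (G.matchingTuples (d + 1)).toFinset | s 0 = σ} : ℕ) : ℝ) ≤ B := by
      intro σ hσ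
      rw [Set.mem_toFinset] at hσ
      refine le_trans ?_ (ih (G.removePerm σ hσ.1) fun x => by
        have := G.ncard_neighborSet_removePerm hσ x
        rw [hreg x] at this
        omega)
      rw [Nat.cast_le, ← Set.ncard_coe_finset]
      refine Set.ncard_le_ncard_of_injOn (fun s => Fin.tail s) ?_ ?_ (Set.toFinite _)
      · intro s hs
        simp only [Finset.coe_filter, Set.mem_toFinset, Set.mem_ofPred_eq] at hs
        obtain ⟨⟨hs1, hs2⟩, rfl⟩ := hs
        refine ⟨fun i => ⟨(hs1 i.succ).1, fun x => ⟨(hs1 i.succ).2 x, ?_⟩⟩, fun i j hij x => ?_⟩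
        · exact hs2 0 i.succ (Fin.succ_ne_zero i).symm x
        · exact hs2 i.succ j.succ (fun h => hij (Fin.succ_injective _ h)) x
      · intro s hs t ht h
        simp only [Finset.coe_filter, Set.mem_ofPred_eq] at hs ht
        rw [← Fin.cons_self_tail s, ← Fin.cons_self_tail t, hs.2, ht.2]
        exact congrArg (Fin.cons (α := fun _ => Equiv.Perm V) σ)
          (show Fin.tail s = Fin.tail t from h)
    have hmaps : ∀ s ∈ (G.matchingTuples (d + 1)).toFinset, s 0 ∈ G.matchingPerms.toFinset := by
      intro s hs
      rw [Set.mem_toFinset] at hs ⊢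
      exact hs.1 0
    rw [Set.ncard_eq_toFinset_card', Finset.card_eq_sum_card_fiberwise hmaps, Nat.cast_sum]
    refine (Finset.sum_le_sum hfib).trans ?_
    rw [Finset.sum_const, nsmul_eq_mul, mul_comm, ← Set.ncard_eq_toFinset_card']
    exact mul_le_mul_of_nonneg_left (G.ncard_matchingPerms_le (d + 1) hreg) hB0

/-- The partner permutation of a perfect matching. -/
theorem Subgraph.IsPerfectMatching.exists_perm {V : Type*} {G : SimpleGraph V} {M : G.Subgraph}
    (hM : M.IsPerfectMatching) :
    ∃ σ : Equiv.Perm V, σ ∈ G.matchingPerms ∧ ∀ x y, M.Adj x y ↔ σ x = y := by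
  rw [Subgraph.isPerfectMatching_iff] at hM
  choose f hf huniq using hM
  have hinv : Function.Involutive f := fun x => (huniq (f x) x (hf x).symm).symm
  refine ⟨hinv.toPerm, ⟨hinv, fun x => (hf x).adj_sub⟩, fun x y => ⟨fun h => ?_, ?_⟩⟩
  · exact (huniq x y h).symm
  · rintro rfl
    exact hf x

end SimpleGraph

/-- Kahn–Lovász iterated: an `n`-vertex `d`-regular graph has at most
`∏_{r=1}^{d} (r!)^{n/(2r)}` ordered 1-factorizations. -/
theorem stmt9 {V : Type*} [Fintype V] (n d : ℕ) (hd : 1 ≤ d)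
    (hn : Fintype.card V = n) (G : SimpleGraph V)
    (hreg : ∀ x : V, (G.neighborSet x).ncard = d) :
    (Nat.card {f : Fin d → SimpleGraph.Subgraph G //
        (∀ i, (f i).IsPerfectMatching) ∧
        (∀ i j, i ≠ j → Disjoint ((f i).edgeSet) ((f j).edgeSet)) ∧
        (⋃ i, (f i).edgeSet) = G.edgeSet} : ℝ) ≤
      ∏ r ∈ Finset.Icc 1 d, (Nat.factorial r : ℝ) ^ ((n : ℝ) / (2 * (r : ℝ))) := by
  classical
  subst hn
  refine le_trans ?_ (SimpleGraph.ncard_matchingTuples_le d G hreg)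
  norm_cast
  rw [← Nat.card_coe_set_eq]
  have hpm : ∀ M : {M : G.Subgraph // M.IsPerfectMatching}, ∃ σ : Equiv.Perm V,
      σ ∈ G.matchingPerms ∧ ∀ x y, M.1.Adj x y ↔ σ x = y := fun M => M.2.exists_perm
  choose P hP hadj using hpm
  refine Nat.card_le_card_of_injective
    (fun f => ⟨fun i => P ⟨f.1 i, f.2.1 i⟩, fun i => hP _, fun i j hij x h => ?_⟩) ?_
  · have h1 : s(x, P ⟨f.1 i, f.2.1 i⟩ x) ∈ (f.1 i).edgeSet := (hadj ⟨f.1 i, f.2.1 i⟩ _ _).2 rfl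
    have h2 : s(x, P ⟨f.1 i, f.2.1 i⟩ x) ∈ (f.1 j).edgeSet :=
      (hadj ⟨f.1 j, f.2.1 j⟩ _ _).2 h.symm
    exact Set.disjoint_left.1 (f.2.2.1 i j hij) h1 h2
  · intro f g h
    refine Subtype.ext (funext fun i => ?_)
    have hi := congrFun (congrArg Subtype.val h) i
    refine SimpleGraph.Subgraph.ext ?_ ?_
    · rw [SimpleGraph.Subgraph.isSpanning_iff.1 (f.2.1 i).2,
        SimpleGraph.Subgraph.isSpanning_iff.1 (g.2.1 i).2]
    · ext x y
      rw [hadj ⟨f.1 i, f.2.1 i⟩, hadj ⟨g.1 i, g.2.1 i⟩]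
      exact iff_of_eq (congrArg (fun σ : Equiv.Perm V => σ x = y) hi)
end
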